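/- arXiv:2101.09107 — 3 statements merged into one kernel-verified Lean document; each statement's English description precedes it below -/
import Mathlib

section
/- Lemma 1: for any history H, any labs l, l' ∈ {1,…,N}, and any times t, t' ∈ {1,…,T}, the inner product ⟨ψ̄_{(l',t',H)} | ψ̄_{(l,t,H)}⟩ = 0 unless l = l' and t = t'. -/
noncomputable section

/-!
Shared framework: quantum protocols with a quantum control of causal order,
following Purves & Short, "Quantum theory cannot violate a causal inequality".

The total Hilbert space `H_s ⊗ H_c ⊗ (⊗ᵢ H_{rᵢ}) ⊗ (⊗ᵢ H_{fᵢ})` is modelled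
concretely as `ℓ²` of the finite basis-index set
`Idx = S × Fin (N+1) × (Π i, A i) × (Π i, Fin (T+1))`
(system basis, control basis |0⟩,…,|N⟩, result-register bases, flag bases),
vectors being functions `Idx → ℂ`, operators being matrices.
-/

namespace CIQ

variable {N T : ℕ} {S : Type} [Fintype S] [DecidableEq S]
variable {A : Fin N → Type} [∀ i, Fintype (A i)] [∀ i, DecidableEq (A i)]
variable {X : Fin N → Type} [∀ i, Fintype (X i)] [∀ i, DecidableEq (X i)]

/-- Basis index set of the total Hilbert space: system × control × results × flags. -/
abbrev Idx (N T : ℕ) (S : Type) (A : Fin N → Type) : Type :=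
  S × Fin (N + 1) × ((i : Fin N) → A i) × ((i : Fin N) → Fin (T + 1))

/-- A history: an ordered list of triples (lab, outcome, setting). -/
abbrev Hist (N : ℕ) (A X : Fin N → Type) : Type := List ((l : Fin N) × (A l × X l))

/-- The labs occurring in a history are pairwise distinct. -/
def labsDistinct (H : Hist N A X) : Prop := (H.map Sigma.fst).Nodup

/-- Squared ℓ²-norm ‖v‖². -/
def nsq (v : Idx N T S A → ℂ) : ℝ := ∑ p, Complex.normSq (v p)

/-- The ℓ² inner product ⟨v|w⟩ (conjugate-linear in the first argument). -/
def hinner (v w : Idx N T S A → ℂ) : ℂ := ∑ p, (starRingEnd ℂ) (v p) * w p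

/-- The data of a quantum protocol: a distinguished initial system basis state `s0`,
initial result-register states `r0`, measurement unitaries `Vm l x` on `H_s ⊗ H_{r_l}`
for each lab and setting, and inter-step unitaries `U t` on `H_s ⊗ H_c` (for `1 ≤ t ≤ T`). -/
structure Protocol (N T : ℕ) (S : Type) (A X : Fin N → Type) where
  s0 : S
  r0 : ∀ i, A i
  Vm : (l : Fin N) → X l → Matrix (S × A l) (S × A l) ℂ
  U : ℕ → Matrix (S × Fin (N + 1)) (S × Fin (N + 1)) ℂ

/-- Extension of an operator on `H_s ⊗ H_c` by the identity on results and flags. -/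
def extSC (M : Matrix (S × Fin (N + 1)) (S × Fin (N + 1)) ℂ) :
    Matrix (Idx N T S A) (Idx N T S A) ℂ := fun p q =>
  if p.2.2 = q.2.2 then M (p.1, p.2.1) (q.1, q.2.1) else 0

namespace Protocol

variable (P : Protocol N T S A X) (x : ∀ l, X l)

/-- Each measurement unitary is indeed unitary. -/
def unitaryVm : Prop := ∀ (l : Fin N) (xv : X l), P.Vm l xv ∈ Matrix.unitaryGroup (S × A l) ℂ

/-- Each inter-step unitary `U t`, `1 ≤ t ≤ T`, is indeed unitary. -/
def unitaryU : Prop :=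
  ∀ t : ℕ, 1 ≤ t → t ≤ T → P.U t ∈ Matrix.unitaryGroup (S × Fin (N + 1)) ℂ

/-- The initial state |0⟩ = |0⟩_s |0⟩_c |0⟩_r^N |0⟩_f^N. -/
def ket0 : Idx N T S A → ℂ :=
  fun p => if p = (P.s0, 0, P.r0, fun _ => 0) then 1 else 0

/-- The lab-activation unitary
`V = |0⟩⟨0|_c ⊗ I + Σ_{l=1}^N |l⟩⟨l|_c ⊗ V_{s,r_l}(x_l) ⊗ Γ_{f_l} ⊗ I`,
where `Γ` is the cyclic shift raising the flag. -/
def Vmat : Matrix (Idx N T S A) (Idx N T S A) ℂ := fun p q =>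
  if h : p.2.1 = (0 : Fin (N + 1)) then (if q = p then 1 else 0)
  else
    if q.2.1 = p.2.1 ∧ (∀ i, i ≠ p.2.1.pred h → q.2.2.1 i = p.2.2.1 i)
        ∧ (∀ i, i ≠ p.2.1.pred h → q.2.2.2 i = p.2.2.2 i)
        ∧ q.2.2.2 (p.2.1.pred h) + 1 = p.2.2.2 (p.2.1.pred h) then
      P.Vm (p.2.1.pred h) (x (p.2.1.pred h))
        (p.1, p.2.2.1 (p.2.1.pred h)) (q.1, q.2.2.1 (p.2.1.pred h))
    else 0

/-- `chain t = V U_t V U_{t-1} ⋯ V U_1`. -/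
def chain : ℕ → Matrix (Idx N T S A) (Idx N T S A) ℂ
  | 0 => 1
  | t + 1 => P.Vmat x * (extSC (P.U (t + 1)) * chain t)

/-- `pre t = U_t V U_{t-1} ⋯ V U_1` (the evolution just before the `t`-th activation). -/
def pre (t : ℕ) : Matrix (Idx N T S A) (Idx N T S A) ℂ :=
  extSC (P.U t) * P.chain x (t - 1)

/-- The total unitary `𝒰 = V U_T V U_{T-1} ⋯ V U_1`. -/
def Uop : Matrix (Idx N T S A) (Idx N T S A) ℂ := P.chain x T

/-- `tailPhi k = V U_T V U_{T-1} ⋯ U_{T-k+1}` (evolution to the end of the protocol,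
starting just after the `(T-k)`-th activation); `k` counts remaining time steps. -/
def tailPhi : ℕ → Matrix (Idx N T S A) (Idx N T S A) ℂ
  | 0 => 1
  | k + 1 => tailPhi k * (P.Vmat x * extSC (P.U (T - k)))

end Protocol

/-- The condition imposed by the projector `π^H_{rf}`: result registers of labs in the
history `H` show the recorded outcomes and their flags are raised (to `1`), while the
flags of all other labs read `0`. -/
def histSat (H : Hist N A X) (rr : ∀ i, A i) (ff : (i : Fin N) → Fin (T + 1)) : Prop :=
  (∀ e ∈ H, rr e.1 = e.2.1 ∧ ff e.1 = 1) ∧ (∀ i : Fin N, (∀ e ∈ H, e.1 ≠ i) → ff i = 0)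

instance (H : Hist N A X) (rr : ∀ i, A i) (ff : (i : Fin N) → Fin (T + 1)) :
    Decidable (histSat H rr ff) := by
  unfold histSat; infer_instance

namespace Protocol

variable (P : Protocol N T S A X) (x : ∀ l, X l)

/-- `|ψ_{(l,t,H)}⟩ = (|l⟩⟨l|_c ⊗ π^H_{rf} ⊗ I_s) U_t V U_{t-1} ⋯ V U_1 |0⟩`,
where the control value `l ∈ {0,1,…,N}`. -/
def psi (l : Fin (N + 1)) (t : ℕ) (H : Hist N A X) : Idx N T S A → ℂ := fun p =>
  if p.2.1 = l ∧ histSat H p.2.2.1 p.2.2.2 then (P.pre x t).mulVec (P.ket0) p else 0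

/-- `|ψ̄_{(l,t,H)}⟩ = V U_T V U_{T-1} ⋯ U_{t+1} V |ψ_{(l,t,H)}⟩`. -/
def psibar (l : Fin (N + 1)) (t : ℕ) (H : Hist N A X) : Idx N T S A → ℂ :=
  (P.tailPhi x (T - t) * P.Vmat x).mulVec (P.psi x l t H)

/-- The just-measured state with previous history `H`:
`(|a⟩⟨a|_{r_l} ⊗ I) V |ψ_{(l,t,H)}⟩` (control value `l` among `1,…,N`). -/
def phiOf (l : Fin N) (a : A l) (t : ℕ) (H : Hist N A X) : Idx N T S A → ℂ := fun p =>
  if p.2.2.1 l = a then (P.Vmat x).mulVec (P.psi x l.succ t H) p else 0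

/-- `|φ_{(l,t,H)}⟩` for a lab `l` whose triple `(l, a, x_l)` occurs in the history `H`:
`(|a⟩⟨a|_{r_l} ⊗ I) V |ψ_{(l,t,H∖(l,a,x_l))}⟩`. -/
def phiFull (l : Fin N) (a : A l) (t : ℕ) (H : Hist N A X) : Idx N T S A → ℂ :=
  P.phiOf x l a t (H.filter fun e => decide (e.1 ≠ l))

/-- `|φ̄_{(l,t,H)}⟩ = V U_T V ⋯ U_{t+1} |φ_{(l,t,H)}⟩`. -/
def phibar (l : Fin N) (a : A l) (t : ℕ) (H : Hist N A X) : Idx N T S A → ℂ :=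
  (P.tailPhi x (T - t)).mulVec (P.phiFull x l a t H)

/-- `|φ_{(0,t,H)}⟩ = V |ψ_{(0,t,H)}⟩`. -/
def phi0 (t : ℕ) (H : Hist N A X) : Idx N T S A → ℂ :=
  (P.Vmat x).mulVec (P.psi x 0 t H)

/-- `|φ̄_{(0,t,H)}⟩ = V U_T V ⋯ U_{t+1} |φ_{(0,t,H)}⟩`. -/
def phibar0 (t : ℕ) (H : Hist N A X) : Idx N T S A → ℂ :=
  (P.tailPhi x (T - t)).mulVec (P.phi0 x t H)

/-- `Σ_{t=1}^T ‖ψ_{(l,t,H)}‖²` (numerator of Definition 4). -/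
def numPsi (H : Hist N A X) (l : Fin N) : ℝ :=
  ∑ t ∈ Finset.Icc 1 T, nsq (P.psi x l.succ t H)

/-- `Σ_{l'∉ℒ} Σ_{t=1}^T ‖ψ_{(l',t,H)}‖²` (denominator of Definition 4). -/
def denPsi (H : Hist N A X) : ℝ :=
  ∑ l ∈ Finset.univ.filter (fun l : Fin N => ∀ e ∈ H, e.1 ≠ l), P.numPsi x H l

/-- Definition 4: `p_k(l_k|H_{k-1})`, the probability for lab `l` to act next. -/
def pNext (H : Hist N A X) (l : Fin N) : ℝ := P.numPsi x H l / P.denPsi x H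

/-- `Σ_{t=1}^T ‖φ_{(l,t,(H,(l,a,x_l)))}‖²` (numerator of Definition 5). -/
def numPhi (H : Hist N A X) (l : Fin N) (a : A l) : ℝ :=
  ∑ t ∈ Finset.Icc 1 T, nsq (P.phiOf x l a t H)

/-- Definition 5: `p_k(a|H_{k-1},x_l)`, the probability for lab `l`, acting next after
history `H` with its setting `x l`, to obtain outcome `a`. -/
def pOut (H : Hist N A X) (l : Fin N) (a : A l) : ℝ :=
  P.numPhi x H l a / ∑ a' : A l, P.numPhi x H l a'

/-- The quantum outcome distribution
`p^quantum(a⃗|x⃗) = ‖(|a⃗⟩⟨a⃗|_r ⊗ I) 𝒰 |0⟩‖²`. -/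
def pQ (a : ∀ i, A i) : ℝ :=
  nsq (fun p => if p.2.2.1 = a then (P.Uop x).mulVec P.ket0 p else 0)

/-- The flag constraint: at the end of the protocol every flag reads `1`
(each party has interacted with the system exactly once). -/
def flagOK : Prop :=
  ∀ p : Idx N T S A, (P.Uop x).mulVec P.ket0 p ≠ 0 → ∀ i, p.2.2.2 i = 1

end Protocol

/-- The causal-model expression of Definition 1, written recursively:
`causalSum q o x a k H` sums over the next `k` parties to act (those not in `H`),
multiplying the 'who is next?' probabilities `q` and the 'what did they see?'
probabilities `o`, with the history extended accordingly.  The full expression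
of Definition 1 is `causalSum q o x a N []`. -/
def causalSum (q : Hist N A X → Fin N → ℝ)
    (o : Hist N A X → (l : Fin N) → X l → A l → ℝ)
    (x : ∀ i, X i) (a : ∀ i, A i) : ℕ → Hist N A X → ℝ
  | 0, _ => 1
  | k + 1, H =>
      ∑ l : Fin N,
        if ∀ e ∈ H, e.1 ≠ l then
          q H l * o H l (x l) (a l) * causalSum q o x a k (H ++ [⟨l, (a l, x l)⟩])
        else 0

end CIQ

end


open CIQ CIQ.Protocol

namespace CIQ

set_option linter.unusedSectionVars false

variable {N T : ℕ} {S : Type} [Fintype S] [DecidableEq S]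
variable {A : Fin N → Type} [∀ i, Fintype (A i)] [∀ i, DecidableEq (A i)]
variable {X : Fin N → Type} [∀ i, Fintype (X i)] [∀ i, DecidableEq (X i)]

theorem hinner_eq_dotProduct (v w : Idx N T S A → ℂ) : hinner v w = star v ⬝ᵥ w := rfl

theorem hinner_conj_symm (v w : Idx N T S A → ℂ) :
    (starRingEnd ℂ) (hinner v w) = hinner w v := by
  simp [hinner, mul_comm]

theorem hinner_eq_zero_of_forall {v w : Idx N T S A → ℂ} (h : ∀ p, v p ≠ 0 → w p = 0) :
    hinner v w = 0 := by
  refine Finset.sum_eq_zero fun p _ => ?_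
  by_cases hp : v p = 0
  · simp [hp]
  · simp [h p hp]

theorem hinner_mulVec_of_mem_unitaryGroup {M : Matrix (Idx N T S A) (Idx N T S A) ℂ}
    (hM : M ∈ Matrix.unitaryGroup (Idx N T S A) ℂ) (v w : Idx N T S A → ℂ) :
    hinner (M.mulVec v) (M.mulVec w) = hinner v w := by
  have h : M.conjTranspose * M = 1 := Matrix.mem_unitaryGroup_iff'.1 hM
  rw [hinner_eq_dotProduct, hinner_eq_dotProduct, Matrix.star_mulVec,
    ← Matrix.dotProduct_mulVec, Matrix.mulVec_mulVec, h, Matrix.one_mulVec]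

theorem extSC_mem_unitaryGroup {M : Matrix (S × Fin (N + 1)) (S × Fin (N + 1)) ℂ}
    (hM : M ∈ Matrix.unitaryGroup (S × Fin (N + 1)) ℂ) :
    (extSC M : Matrix (Idx N T S A) (Idx N T S A) ℂ) ∈
      Matrix.unitaryGroup (Idx N T S A) ℂ := by
  rw [Matrix.mem_unitaryGroup_iff] at hM ⊢
  ext p q
  have hpq := congrFun (congrFun hM (p.1, p.2.1)) (q.1, q.2.1)
  simp only [Matrix.mul_apply, Matrix.star_apply] at hpq ⊢
  rw [← Fintype.sum_of_injective
    (fun z : S × Fin (N + 1) => ((z.1, z.2, p.2.2) : Idx N T S A)) _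
    (fun z => M (p.1, p.2.1) z *
      star (if q.2.2 = p.2.2 then M (q.1, q.2.1) z else 0))]
  · by_cases h : q.2.2 = p.2.2
    · simp only [h, if_true, hpq, Matrix.one_apply]
      refine if_congr ?_ rfl rfl
      simp [Prod.ext_iff] at h ⊢
      tauto
    · have : p ≠ q := fun e => h (by rw [e])
      simp [h, Matrix.one_apply_ne this]
  · intro r hr
    have : p.2.2 ≠ r.2.2 := fun e => hr ⟨(r.1, r.2.1), by rw [e]⟩
    simp [extSC, this]
  · intro z
    simp [extSC]
  · rintro ⟨a, b⟩ ⟨c, d⟩ h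
    simpa using h

namespace Protocol

variable (P : Protocol N T S A X) (x : ∀ l, X l)

theorem Vmat_apply_zero {p : Idx N T S A} (hp : p.2.1 = 0) (q : Idx N T S A) :
    P.Vmat x p q = if q = p then 1 else 0 := by
  simp [Vmat, hp]

theorem Vmat_apply_succ {p : Idx N T S A} {l : Fin N} (hp : p.2.1 = l.succ)
    (q : Idx N T S A) :
    P.Vmat x p q =
      if q.2.1 = l.succ ∧ (∀ i, i ≠ l → q.2.2.1 i = p.2.2.1 i)
        ∧ (∀ i, i ≠ l → q.2.2.2 i = p.2.2.2 i) ∧ q.2.2.2 l + 1 = p.2.2.2 l then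
        P.Vm l (x l) (p.1, p.2.2.1 l) (q.1, q.2.2.1 l)
      else 0 := by
  obtain ⟨s, c, r, f⟩ := p
  obtain rfl : c = l.succ := hp
  exact dif_neg (Fin.succ_ne_zero l)

theorem control_eq_of_Vmat_ne_zero {p q : Idx N T S A} (h : P.Vmat x p q ≠ 0) :
    q.2.1 = p.2.1 := by
  rcases Fin.eq_zero_or_eq_succ p.2.1 with hp | ⟨l, hp⟩
  · rw [Vmat_apply_zero P x hp] at h
    rw [(ite_ne_right_iff.1 h).1]
  · rw [Vmat_apply_succ P x hp] at h
    rw [(ite_ne_right_iff.1 h).1.1, hp]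

theorem Vmat_mem_unitaryGroup (hVm : P.unitaryVm) :
    (P.Vmat x : Matrix (Idx N T S A) (Idx N T S A) ℂ) ∈
      Matrix.unitaryGroup (Idx N T S A) ℂ := by
  rw [Matrix.mem_unitaryGroup_iff]
  ext p q
  simp only [Matrix.mul_apply, Matrix.star_apply]
  rcases Fin.eq_zero_or_eq_succ p.2.1 with hp | ⟨l, hp⟩
  · simp only [Vmat_apply_zero P x hp, ite_mul, one_mul, zero_mul, Finset.sum_ite_eq',
      Finset.mem_univ, if_true]
    by_cases hc : p.2.1 = q.2.1
    · rw [Vmat_apply_zero P x (hc ▸ hp), Matrix.one_apply]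
      split_ifs <;> simp
    · have h0 : P.Vmat x q p = 0 := by
        by_contra h
        exact hc (P.control_eq_of_Vmat_ne_zero x h)
      rw [h0, star_zero, Matrix.one_apply_ne (fun e => hc (by rw [e]))]
  · have hM := Matrix.mem_unitaryGroup_iff.1 (hVm l (x l))
    have hpq := congrFun (congrFun hM (p.1, p.2.2.1 l)) (q.1, q.2.2.1 l)
    simp only [Matrix.mul_apply, Matrix.star_apply] at hpq
    rw [← Fintype.sum_of_injective
      (fun z : S × A l => ((z.1, l.succ, Function.update p.2.2.1 l z.2,
        Function.update p.2.2.2 l (p.2.2.2 l - 1)) : Idx N T S A)) _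
      (fun z => P.Vm l (x l) (p.1, p.2.2.1 l) z *
        star (if q.2.1 = l.succ ∧ (∀ i, i ≠ l → p.2.2.1 i = q.2.2.1 i)
          ∧ p.2.2.2 = q.2.2.2 then P.Vm l (x l) (q.1, q.2.2.1 l) z else 0))]
    · by_cases h : q.2.1 = l.succ ∧ (∀ i, i ≠ l → p.2.2.1 i = q.2.2.1 i)
          ∧ p.2.2.2 = q.2.2.2
      · simp only [if_pos h, hpq, Matrix.one_apply]
        refine if_congr ?_ rfl rfl
        obtain ⟨h1, h2, h3⟩ := h
        constructor
        · intro e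
          simp only [Prod.mk.injEq] at e
          refine Prod.ext e.1 (Prod.ext (hp.trans h1.symm) (Prod.ext (funext fun i => ?_) h3))
          by_cases hi : i = l
          · subst hi; exact e.2
          · exact h2 i hi
        · rintro rfl; rfl
      · have : p ≠ q := by
          rintro rfl
          exact h ⟨hp, fun _ _ => rfl, rfl⟩
        simp [h, Matrix.one_apply_ne this]
    · intro r hr
      rw [Vmat_apply_succ P x hp, if_neg, zero_mul]
      rintro ⟨h1, h2, h3, h4⟩
      refine hr ⟨(r.1, r.2.2.1 l), Prod.ext rfl (Prod.ext h1.symm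
        (Prod.ext (funext fun i => ?_) (funext fun i => ?_)))⟩
      · by_cases hi : i = l
        · subst hi; simp
        · simp [hi, h2 i hi]
      · by_cases hi : i = l
        · subst hi; simp [← h4]
        · simp [hi, h3 i hi]
    · intro z
      refine congrArg₂ _ ?_ (congrArg star ?_)
      · rw [Vmat_apply_succ P x hp, if_pos]
        · simp only [Function.update_self]
        · refine ⟨rfl, fun i hi => ?_, fun i hi => ?_, ?_⟩ <;> simp [*]
      · by_cases hq : q.2.1 = l.succ
        · rw [Vmat_apply_succ P x hq]
          simp only [Function.update_self]
          refine (if_congr ?_ rfl rfl)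
          constructor
          · rintro ⟨-, h2, h3⟩
            refine ⟨trivial, fun i hi => ?_, fun i hi => ?_, ?_⟩
            · simp [hi, h2 i hi]
            · simp [hi, h3]
            · simp [h3]
          · rintro ⟨-, h2, h3, h4⟩
            refine ⟨hq, fun i hi => ?_, funext fun i => ?_⟩
            · simpa [hi] using h2 i hi
            · by_cases hi : i = l
              · subst hi; simpa using h4
              · simpa [hi] using h3 i hi
        · rw [if_neg (fun h => hq h.1)]
          by_contra h
          exact hq (P.control_eq_of_Vmat_ne_zero x (Ne.symm h)).symm
    · rintro ⟨a, b⟩ ⟨c, d⟩ h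
      simp only [Prod.mk.injEq] at h
      have := congrFun h.2.2.1 l
      simp only [Function.update_self] at this
      rw [h.1, this]

theorem tailPhi_mem_unitaryGroup (hVm : P.unitaryVm) (hU : P.unitaryU) {k : ℕ}
    (hk : k ≤ T) :
    (P.tailPhi x k : Matrix (Idx N T S A) (Idx N T S A) ℂ) ∈
      Matrix.unitaryGroup (Idx N T S A) ℂ := by
  induction k with
  | zero => exact one_mem _
  | succ k ih =>
    exact mul_mem (ih (by omega)) (mul_mem (P.Vmat_mem_unitaryGroup x hVm)
      (extSC_mem_unitaryGroup (hU _ (by omega) (by omega))))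

end Protocol

/-- On the support of `v`, the flag of lab `l` is `f` raised between `1` and `m` times. -/
def FlagRaised (l : Fin N) (f : Fin (T + 1)) (m : ℕ) (v : Idx N T S A → ℂ) : Prop :=
  ∀ p, v p ≠ 0 → ∃ d : ℕ, 1 ≤ d ∧ d ≤ m ∧ p.2.2.2 l = f + Fin.ofNat (T + 1) d

theorem exists_ne_zero_of_mulVec_ne_zero {M : Matrix (Idx N T S A) (Idx N T S A) ℂ}
    {v : Idx N T S A → ℂ} {p : Idx N T S A} (h : M.mulVec v p ≠ 0) :
    ∃ q, M p q ≠ 0 ∧ v q ≠ 0 := by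
  obtain ⟨q, -, hq⟩ := Finset.exists_ne_zero_of_sum_ne_zero h
  exact ⟨q, left_ne_zero_of_mul hq, right_ne_zero_of_mul hq⟩

theorem FlagRaised.extSC_mulVec {l : Fin N} {f : Fin (T + 1)} {m : ℕ}
    {v : Idx N T S A → ℂ} (hv : FlagRaised l f m v)
    (M : Matrix (S × Fin (N + 1)) (S × Fin (N + 1)) ℂ) :
    FlagRaised l f m ((extSC M).mulVec v) := by
  intro p hp
  obtain ⟨q, hq, hvq⟩ := exists_ne_zero_of_mulVec_ne_zero hp
  obtain ⟨d, h⟩ := hv q hvq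
  exact ⟨d, by rwa [(ite_ne_right_iff.1 hq).1]⟩

namespace Protocol

variable (P : Protocol N T S A X) (x : ∀ l, X l)

theorem flag_of_Vmat_ne_zero {p q : Idx N T S A} (h : P.Vmat x p q ≠ 0) (l : Fin N) :
    p.2.2.2 l = q.2.2.2 l ∨ p.2.2.2 l = q.2.2.2 l + 1 := by
  rcases Fin.eq_zero_or_eq_succ p.2.1 with hp | ⟨j, hp⟩
  · rw [Vmat_apply_zero P x hp] at h
    exact Or.inl (by rw [(ite_ne_right_iff.1 h).1])
  · rw [Vmat_apply_succ P x hp] at h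
    obtain ⟨-, -, h3, h4⟩ := (ite_ne_right_iff.1 h).1
    by_cases hl : l = j
    · subst hl; exact Or.inr h4.symm
    · exact Or.inl (h3 l hl).symm

theorem _root_.CIQ.FlagRaised.Vmat_mulVec {l : Fin N} {f : Fin (T + 1)} {m : ℕ}
    {v : Idx N T S A → ℂ} (hv : FlagRaised l f m v) :
    FlagRaised l f (m + 1) ((P.Vmat x).mulVec v) := by
  intro p hp
  obtain ⟨q, hq, hvq⟩ := exists_ne_zero_of_mulVec_ne_zero hp
  obtain ⟨d, h1, h2, h3⟩ := hv q hvq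
  rcases P.flag_of_Vmat_ne_zero x hq l with h | h
  · exact ⟨d, h1, by omega, h.trans h3⟩
  · exact ⟨d + 1, by omega, by omega, by
      rw [h, h3, add_assoc]
      congr 1
      simp [Fin.ext_iff, Fin.val_add]⟩

theorem flagRaised_Vmat_psi {l : Fin N} {t : ℕ} {H : Hist N A X} {f : Fin (T + 1)}
    (hf : ∀ p : Idx N T S A, histSat H p.2.2.1 p.2.2.2 → p.2.2.2 l = f) :
    FlagRaised l f 1 ((P.Vmat x).mulVec (P.psi x l.succ t H)) := by
  intro p hp
  obtain ⟨q, hq, hvq⟩ := exists_ne_zero_of_mulVec_ne_zero hp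
  obtain ⟨hc, hs⟩ := (ite_ne_right_iff.1 hvq).1
  have hpc : p.2.1 = l.succ := (P.control_eq_of_Vmat_ne_zero x hq).symm.trans hc
  rw [Vmat_apply_succ P x hpc] at hq
  refine ⟨1, le_rfl, le_rfl, ?_⟩
  rw [← (ite_ne_right_iff.1 hq).1.2.2.2, hf q hs]
  rfl

theorem exists_tailPhi_mulVec_eq {l : Fin N} {f : Fin (T + 1)} (k j : ℕ) {m : ℕ}
    {v : Idx N T S A → ℂ} (hv : FlagRaised l f m v) :
    ∃ w, FlagRaised l f (m + j) w ∧
      (P.tailPhi x (k + j + 1)).mulVec v = (P.tailPhi x k * P.Vmat x).mulVec w := by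
  induction j generalizing m v with
  | zero =>
    refine ⟨_, hv.extSC_mulVec (P.U (T - k)), ?_⟩
    simp [tailPhi, Matrix.mulVec_mulVec, Matrix.mul_assoc]
  | succ j ih =>
    obtain ⟨w, hw, h⟩ := ih ((hv.extSC_mulVec (P.U (T - (k + j + 1)))).Vmat_mulVec P x)
    refine ⟨w, by rwa [add_right_comm] at hw, ?_⟩
    rw [← h, Matrix.mulVec_mulVec, Matrix.mulVec_mulVec, ← add_assoc k j 1, Matrix.mul_assoc, ← tailPhi]

theorem exists_flag_eq_of_histSat (H : Hist N A X) (l : Fin N) :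
    ∃ f : Fin (T + 1), ∀ p : Idx N T S A, histSat H p.2.2.1 p.2.2.2 → p.2.2.2 l = f := by
  by_cases h : ∃ e ∈ H, e.1 = l
  · obtain ⟨e, he, rfl⟩ := h
    exact ⟨1, fun p hp => (hp.1 e he).2⟩
  · push Not at h
    exact ⟨0, fun p hp => hp.2 l h⟩

theorem hinner_psibar_eq_zero_of_lt (hVm : P.unitaryVm) (hU : P.unitaryU) (H : Hist N A X)
    (l : Fin N) (c : Fin (N + 1)) {s t : ℕ} (hst : s < t) (ht : t ≤ T) :
    hinner (P.psibar x l.succ s H) (P.psibar x c t H) = 0 := by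
  obtain ⟨f, hf⟩ := exists_flag_eq_of_histSat (T := T) (S := S) H l
  obtain ⟨w, hw, h⟩ := P.exists_tailPhi_mulVec_eq x (T - t) (t - s - 1)
    (P.flagRaised_Vmat_psi x (t := s) hf)
  rw [show T - t + (t - s - 1) + 1 = T - s by omega, Matrix.mulVec_mulVec] at h
  unfold psibar
  rw [h, hinner_mulVec_of_mem_unitaryGroup
    (mul_mem (P.tailPhi_mem_unitaryGroup x hVm hU (by omega)) (P.Vmat_mem_unitaryGroup x hVm))]
  refine hinner_eq_zero_of_forall fun p hp => ?_
  by_contra hq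
  obtain ⟨d, h1, h2, h3⟩ := hw p hp
  rw [hf p (ite_ne_right_iff.1 hq).1.2, left_eq_add, Fin.ext_iff] at h3
  replace h3 : T + 1 ∣ d := Nat.dvd_of_mod_eq_zero h3
  have := Nat.le_of_dvd h1 h3
  omega

theorem hinner_psibar_eq_zero_of_ne (hVm : P.unitaryVm) (hU : P.unitaryU) (H : Hist N A X)
    {c c' : Fin (N + 1)} (hc : c' ≠ c) (t : ℕ) :
    hinner (P.psibar x c' t H) (P.psibar x c t H) = 0 := by
  unfold psibar
  rw [hinner_mulVec_of_mem_unitaryGroup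
    (mul_mem (P.tailPhi_mem_unitaryGroup x hVm hU (by omega)) (P.Vmat_mem_unitaryGroup x hVm))]
  refine hinner_eq_zero_of_forall fun p hp => ?_
  exact if_neg fun h => hc ((ite_ne_right_iff.1 hp).1.1.symm.trans h.1)

end Protocol

end CIQ

/-- **Lemma 1**: for any history `H`, labs `l, l' ∈ {1,…,N}` and times
`t, t' ∈ {1,…,T}`, we have `⟨ψ̄_(l',t',H) | ψ̄_(l,t,H)⟩ = 0` unless `l = l'` and `t = t'`. -/
theorem lemma_one
    (N T : ℕ) (S : Type) [Fintype S] [DecidableEq S]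
    (A : Fin N → Type) [∀ i, Fintype (A i)] [∀ i, DecidableEq (A i)]
    (X : Fin N → Type) [∀ i, Fintype (X i)] [∀ i, DecidableEq (X i)]
    (hN : 1 ≤ N) (hT : N ≤ T)
    (P : Protocol N T S A X) (hVm : P.unitaryVm) (hU : P.unitaryU)
    (x : ∀ l, X l) (H : Hist N A X) (hH : labsDistinct H)
    (l l' : Fin N) (t t' : ℕ)
    (ht : t ∈ Finset.Icc 1 T) (ht' : t' ∈ Finset.Icc 1 T)
    (hne : ¬ (l = l' ∧ t = t')) :
    hinner (P.psibar x l'.succ t' H) (P.psibar x l.succ t H) = 0 := by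
  rcases lt_trichotomy t' t with h | rfl | h
  · exact P.hinner_psibar_eq_zero_of_lt x hVm hU H l' _ h (Finset.mem_Icc.1 ht).2
  · refine P.hinner_psibar_eq_zero_of_ne x hVm hU H (fun e => hne ⟨?_, rfl⟩) _
    exact (Fin.succ_injective _ e).symm
  · rw [← hinner_conj_symm,
      P.hinner_psibar_eq_zero_of_lt x hVm hU H l _ h (Finset.mem_Icc.1 ht').2, map_zero]
end

section
/- Result 1: for any history H_{k−1} with distinct labs ℒ_{k−1}, any lab l_k ∉ ℒ_{k−1}, and its setting x_{l_k}: Σ_{a'∈𝒜_{l_k}} Σ_{t=1}^T ‖φ_{(l_k,t,H'_k)}‖² = Σ_{t=1}^T ‖ψ_{(l_k,t,H_{k−1})}‖², where H'_k = (H_{k−1}, (l_k, a', x_{l_k})). Consequently, whenever the denominators are nonzero, p_k(l_k|H_{k−1}) · p_k(a_{l_k}|H_{k−1}, x_{l_k}) = (Σ_{t=1}^T ‖φ_{(l_k,t,H_k)}‖²) / (Σ_{l'∉ℒ_{k−1}} Σ_{t'=1}^T ‖ψ_{(l',t',H_{k−1})}‖²). -/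
open CIQ CIQ.Protocol

namespace CIQ

variable {N T : ℕ} {S : Type} [Fintype S] [DecidableEq S]
variable {A : Fin N → Type} [∀ i, Fintype (A i)] [∀ i, DecidableEq (A i)]
variable {X : Fin N → Type} [∀ i, Fintype (X i)] [∀ i, DecidableEq (X i)]

set_option linter.unusedSectionVars false

/-- A unitary matrix preserves the squared `ℓ²` norm. -/
lemma sum_normSq_mulVec_of_mem_unitaryGroup {n : Type*} [Fintype n] [DecidableEq n]
    {M : Matrix n n ℂ} (hM : M ∈ Matrix.unitaryGroup n ℂ) (w : n → ℂ) :
    ∑ i, Complex.normSq (M.mulVec w i) = ∑ i, Complex.normSq (w i) := by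
  have key : ∀ u : n → ℂ, ((∑ i, Complex.normSq (u i) : ℝ) : ℂ) = star u ⬝ᵥ u := by
    intro u
    simp [dotProduct, Complex.normSq_eq_conj_mul_self]
  apply Complex.ofReal_injective
  rw [key, key, Matrix.star_mulVec, ← Matrix.dotProduct_mulVec, Matrix.mulVec_mulVec,
    ← Matrix.star_eq_conjTranspose, Matrix.mem_unitaryGroup_iff'.mp hM, Matrix.one_mulVec]

/-- Summing the squared norms over the values of one result register gives the squared norm. -/
lemma sum_nsq_ite_register (l : Fin N) (v : Idx N T S A → ℂ) :
    ∑ a : A l, nsq (fun p => if p.2.2.1 l = a then v p else 0) = nsq v := by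
  unfold nsq
  rw [Finset.sum_comm]
  refine Finset.sum_congr rfl fun p _ => ?_
  simp [apply_ite Complex.normSq]

/-- The squared norm of a vector supported on the control value `c`, with the result register
of lab `l` split off. -/
lemma nsq_eq_sum_of_control (l : Fin N) (c : Fin (N + 1)) (v : Idx N T S A → ℂ)
    (hv : ∀ p, p.2.1 ≠ c → v p = 0) :
    nsq v = ∑ f : Fin N → Fin (T + 1), ∑ g : (j : {j // j ≠ l}) → A j, ∑ sa : S × A l,
      Complex.normSq (v (sa.1, c, (Equiv.piSplitAt l A).symm (sa.2, g), f)) := by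
  have h1 : nsq v = ∑ s : S, ∑ r : (∀ i, A i), ∑ f : Fin N → Fin (T + 1),
      Complex.normSq (v (s, c, r, f)) := by
    unfold nsq
    simp only [Fintype.sum_prod_type]
    refine Finset.sum_congr rfl fun s _ => ?_
    refine Finset.sum_eq_single c (fun b _ hb => ?_) (by simp)
    simp [hv (s, b, _, _) hb]
  have h2 : ∀ s : S, ∑ r : (∀ i, A i), ∑ f : Fin N → Fin (T + 1),
      Complex.normSq (v (s, c, r, f)) = ∑ f : Fin N → Fin (T + 1),
        ∑ g : (j : {j // j ≠ l}) → A j, ∑ a : A l,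
          Complex.normSq (v (s, c, (Equiv.piSplitAt l A).symm (a, g), f)) := by
    intro s
    rw [Finset.sum_comm]
    refine Finset.sum_congr rfl fun f _ => ?_
    rw [← (Equiv.piSplitAt l A).symm.sum_comp, Fintype.sum_prod_type, Finset.sum_comm]
  simp only [h1, h2, Fintype.sum_prod_type]
  rw [Finset.sum_comm]
  refine Finset.sum_congr rfl fun f _ => ?_
  rw [Finset.sum_comm]

namespace Protocol

variable (P : Protocol N T S A X) (x : ∀ l, X l)

lemma Vmat_eq_zero_of_control_ne {p q : Idx N T S A} (h : q.2.1 ≠ p.2.1) :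
    P.Vmat x p q = 0 := by
  unfold Vmat
  split_ifs with h0 h1 h2
  · exact absurd (by rw [h1]) h
  · rfl
  · exact absurd h2.1 h
  · rfl

lemma Vmat_succ (l : Fin N) (s s' : S) (c : Fin (N + 1)) (r r' : ∀ i, A i)
    (f f' : Fin N → Fin (T + 1)) :
    P.Vmat x (s, l.succ, r, f) (s', c, r', f') =
      if c = l.succ ∧ (∀ i, i ≠ l → r' i = r i) ∧ (∀ i, i ≠ l → f' i = f i)
        ∧ f' l + 1 = f l then P.Vm l (x l) (s, r l) (s', r' l) else 0 :=
  dif_neg (Fin.succ_ne_zero l)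

/-- Activating lab `l` applies `V_{s,r_l}(x_l)` and raises the flag of `l`. -/
lemma Vmat_mulVec_succ (l : Fin N) (v : Idx N T S A → ℂ) (s : S) (a : A l)
    (g : (j : {j // j ≠ l}) → A j) (f : Fin N → Fin (T + 1)) :
    (P.Vmat x).mulVec v (s, l.succ, (Equiv.piSplitAt l A).symm (a, g), f) =
      (P.Vm l (x l)).mulVec (fun sa : S × A l =>
        v (sa.1, l.succ, (Equiv.piSplitAt l A).symm (sa.2, g), f - Pi.single l 1)) (s, a) := by
  have hr : ∀ (a' : A l) (g' : (j : {j // j ≠ l}) → A j),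
      (∀ i, i ≠ l → (Equiv.piSplitAt l A).symm (a', g') i =
        (Equiv.piSplitAt l A).symm (a, g) i) ↔ g' = g := by
    intro a' g'
    constructor
    · intro h
      funext j
      simpa [Equiv.piSplitAt, j.2] using h j j.2
    · rintro rfl i hi
      simp [Equiv.piSplitAt, hi]
  have hf : ∀ f' : Fin N → Fin (T + 1),
      ((∀ i, i ≠ l → f' i = f i) ∧ f' l + 1 = f l) ↔ f' = f - Pi.single l 1 := by
    intro f'
    constructor
    · rintro ⟨h, h'⟩
      funext i
      by_cases hi : i = l
      · subst hi
        simp [← h']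
      · simp [hi, h i hi]
    · rintro rfl
      refine ⟨fun i hi => by simp [hi], by simp⟩
  have ha : ∀ (a' : A l) (g' : (j : {j // j ≠ l}) → A j),
      (Equiv.piSplitAt l A).symm (a', g') l = a' := by
    intro a' g'
    simp [Equiv.piSplitAt]
  simp only [Matrix.mulVec, dotProduct, Fintype.sum_prod_type, Vmat_succ, hf]
  refine Finset.sum_congr rfl fun s' _ => ?_
  rw [Finset.sum_eq_single l.succ (fun c _ hc => by simp [hc]) (by simp),
    ← (Equiv.piSplitAt l A).symm.sum_comp, Fintype.sum_prod_type]
  refine Finset.sum_congr rfl fun a' _ => ?_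
  simp only [hr, ha, true_and, ite_and, ite_mul, zero_mul]
  simp

/-- Activating lab `l` preserves the norm of vectors with control value `l`. -/
lemma nsq_Vmat_mulVec (hVm : P.unitaryVm) (l : Fin N) (v : Idx N T S A → ℂ)
    (hv : ∀ p, p.2.1 ≠ l.succ → v p = 0) : nsq ((P.Vmat x).mulVec v) = nsq v := by
  have hw : ∀ p, p.2.1 ≠ l.succ → (P.Vmat x).mulVec v p = 0 := by
    intro p hp
    refine Finset.sum_eq_zero fun q _ => ?_
    by_cases hq : q.2.1 = p.2.1
    · rw [hv q (hq ▸ hp), mul_zero]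
    · exact mul_eq_zero_of_left (P.Vmat_eq_zero_of_control_ne x hq) _
  rw [nsq_eq_sum_of_control l l.succ _ hw, nsq_eq_sum_of_control l l.succ v hv]
  conv_rhs => rw [← (Equiv.subRight (Pi.single l 1 : Fin N → Fin (T + 1))).sum_comp]
  refine Finset.sum_congr rfl fun f _ => Finset.sum_congr rfl fun g _ => ?_
  simp only [Vmat_mulVec_succ]
  exact sum_normSq_mulVec_of_mem_unitaryGroup (hVm l (x l)) _

/-- The outcomes of lab `l` exhaust the norm of the states in which `l` acts next. -/
lemma sum_numPhi (hVm : P.unitaryVm) (H : Hist N A X) (l : Fin N) :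
    ∑ a : A l, P.numPhi x H l a = P.numPsi x H l := by
  unfold numPhi numPsi
  rw [Finset.sum_comm]
  refine Finset.sum_congr rfl fun t _ => ?_
  rw [← P.nsq_Vmat_mulVec x hVm l (P.psi x l.succ t H) fun p hp => if_neg fun h => hp h.1]
  exact sum_nsq_ite_register l _

end Protocol

end CIQ

/-- **Result 1**: the numerator of the 'who is next?' probability equals the
denominator of the 'results' probability,
`Σ_(a'∈𝒜_l) Σ_(t=1)^T ‖φ_(l,t,H'_k)‖² = Σ_(t=1)^T ‖ψ_(l,t,H_(k-1))‖²`; consequently,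
whenever the denominators are nonzero,
`p_k(l_k|H_(k-1)) · p_k(a_(l_k)|H_(k-1),x_(l_k))
  = (Σ_t ‖φ_(l_k,t,H_k)‖²) / (Σ_(l'∉ℒ_(k-1)) Σ_(t') ‖ψ_(l',t',H_(k-1))‖²)`. -/
theorem result_one
    (N T : ℕ) (S : Type) [Fintype S] [DecidableEq S]
    (A : Fin N → Type) [∀ i, Fintype (A i)] [∀ i, DecidableEq (A i)]
    (X : Fin N → Type) [∀ i, Fintype (X i)] [∀ i, DecidableEq (X i)]
    (hN : 1 ≤ N) (hT : N ≤ T)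
    (P : Protocol N T S A X) (hVm : P.unitaryVm) (hU : P.unitaryU)
    (x : ∀ l, X l) (H : Hist N A X) (hH : labsDistinct H)
    (l : Fin N) (hl : ∀ e ∈ H, e.1 ≠ l) :
    (∑ a' : A l, P.numPhi x H l a') = P.numPsi x H l ∧
    (∀ a : A l, P.denPsi x H ≠ 0 → (∑ a' : A l, P.numPhi x H l a') ≠ 0 →
      P.pNext x H l * P.pOut x H l a = P.numPhi x H l a / P.denPsi x H) := by
  refine ⟨P.sum_numPhi x hVm H l, fun a _ hne => ?_⟩
  unfold pNext pOut
  rw [P.sum_numPhi x hVm H l] at hne ⊢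
  field_simp
end

section
/- Result 2: under the flag constraint, Σ_{l_1=1}^N Σ_{t_1=1}^T ‖ψ_{(l_1,t_1,H_0)}‖² = 1, where H_0 = ∅ is the empty history (so the denominator of the first 'who is next' probability equals 1). -/
namespace CIQ

variable {N T : ℕ} {S : Type} [Fintype S] {A : Fin N → Type} [∀ i, Fintype (A i)]
variable {X : Fin N → Type}

/-- A unitary matrix preserves the sum of squared moduli of a vector. -/
theorem sum_normSq_unitary_mulVec {n : Type*} [Fintype n] [DecidableEq n] {M : Matrix n n ℂ}
    (hM : M ∈ Matrix.unitaryGroup n ℂ) (v : n → ℂ) :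
    ∑ i, Complex.normSq (M.mulVec v i) = ∑ i, Complex.normSq (v i) := by
  have normSq_sum (w : n → ℂ) : ((∑ i, Complex.normSq (w i) : ℝ) : ℂ) = star w ⬝ᵥ w := by
    push_cast
    exact Finset.sum_congr rfl fun i _ => Complex.normSq_eq_conj_mul_self
  apply Complex.ofReal_injective
  rw [normSq_sum, normSq_sum, Matrix.star_mulVec, Matrix.dotProduct_mulVec,
    Matrix.vecMul_vecMul, ← Matrix.star_eq_conjTranspose, Matrix.mem_unitaryGroup_iff'.mp hM,
    Matrix.vecMul_one]

/-- Summation over the total index set, with the register part outermost. -/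
theorem sum_idx {R : Type*} [AddCommMonoid R] (F : Idx N T S A → R) :
    ∑ p, F p = ∑ y, ∑ z : S × Fin (N + 1), F (z.1, z.2, y) := by
  rw [← (Equiv.prodAssoc S (Fin (N + 1)) _).sum_comp, Fintype.sum_prod_type_right]
  rfl

variable [∀ i, DecidableEq (A i)]

theorem extSC_mulVec (M : Matrix (S × Fin (N + 1)) (S × Fin (N + 1)) ℂ)
    (v : Idx N T S A → ℂ) (p : Idx N T S A) :
    (extSC M).mulVec v p =
      M.mulVec (fun z => v (z.1, z.2, p.2.2)) (p.1, p.2.1) := by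
  simp only [Matrix.mulVec, dotProduct, extSC]
  rw [sum_idx, Finset.sum_eq_single p.2.2]
  · simp
  · intro y _ hy
    simp [hy.symm]
  · simp

theorem extSC_mulVec_flag_le {M : Matrix (S × Fin (N + 1)) (S × Fin (N + 1)) ℂ}
    {v : Idx N T S A → ℂ} {t : ℕ} (hv : ∀ p, v p ≠ 0 → ∀ i, (p.2.2.2 i : ℕ) ≤ t)
    (p : Idx N T S A) (hp : (extSC M).mulVec v p ≠ 0) (i : Fin N) : (p.2.2.2 i : ℕ) ≤ t := by
  rw [extSC_mulVec] at hp
  obtain ⟨z, -, hz⟩ := Finset.exists_ne_zero_of_sum_ne_zero hp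
  exact hv _ (right_ne_zero_of_mul hz) i

/-- The squared norm of the component of `v` on which no flag has been raised. -/
def unraisedWeight (v : Idx N T S A → ℂ) : ℝ :=
  ∑ p, if p.2.2.2 = (fun _ => 0) then Complex.normSq (v p) else 0

theorem unraisedWeight_extSC_mulVec [DecidableEq S]
    {M : Matrix (S × Fin (N + 1)) (S × Fin (N + 1)) ℂ}
    (hM : M ∈ Matrix.unitaryGroup (S × Fin (N + 1)) ℂ) (v : Idx N T S A → ℂ) :
    unraisedWeight ((extSC M).mulVec v) = unraisedWeight v := by
  unfold unraisedWeight
  rw [sum_idx, sum_idx]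
  refine Finset.sum_congr rfl fun y _ => ?_
  by_cases hy : y.2 = fun _ => 0
  · simp only [extSC_mulVec, hy, if_true]
    exact sum_normSq_unitary_mulVec hM fun z => v (z.1, z.2, y)
  · simp [hy]

namespace Protocol

variable [DecidableEq S] (P : Protocol N T S A X) (x : ∀ l, X l)

theorem Vmat_mulVec_of_control_zero (v : Idx N T S A → ℂ) {p : Idx N T S A} (hp : p.2.1 = 0) :
    (P.Vmat x).mulVec v p = v p := by
  simp [Matrix.mulVec, dotProduct, Vmat, hp]

/-- Off the idle control value, an amplitude after activation comes from an amplitude in which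
the flag of the active lab is one step lower and the other flags agree. -/
theorem exists_of_Vmat_mulVec_ne_zero {v : Idx N T S A → ℂ} {p : Idx N T S A}
    (hp : p.2.1 ≠ 0) (h : (P.Vmat x).mulVec v p ≠ 0) :
    ∃ q, v q ≠ 0 ∧ (∀ i, i ≠ p.2.1.pred hp → q.2.2.2 i = p.2.2.2 i) ∧
      q.2.2.2 (p.2.1.pred hp) + 1 = p.2.2.2 (p.2.1.pred hp) := by
  obtain ⟨q, -, hq⟩ := Finset.exists_ne_zero_of_sum_ne_zero h
  refine ⟨q, right_ne_zero_of_mul hq, ?_⟩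
  have hV := left_ne_zero_of_mul hq
  simp only [Vmat, dif_neg hp] at hV
  split_ifs at hV with hc
  · exact hc.2.2
  · exact absurd rfl hV

theorem Vmat_mulVec_flag_le {v : Idx N T S A → ℂ} {t : ℕ}
    (hv : ∀ p, v p ≠ 0 → ∀ i, (p.2.2.2 i : ℕ) ≤ t)
    (p : Idx N T S A) (hp : (P.Vmat x).mulVec v p ≠ 0) (i : Fin N) :
    (p.2.2.2 i : ℕ) ≤ t + 1 := by
  by_cases h0 : p.2.1 = 0
  · rw [Vmat_mulVec_of_control_zero P x v h0] at hp
    exact (hv p hp i).trans t.le_succ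
  · obtain ⟨q, hq, hne, heq⟩ := exists_of_Vmat_mulVec_ne_zero P x h0 hp
    by_cases hi : i = p.2.1.pred h0
    · rw [hi, ← heq, Fin.val_add_one]
      have := hv q hq (p.2.1.pred h0)
      split_ifs <;> omega
    · rw [← hne i hi]
      exact (hv q hq i).trans t.le_succ

theorem chain_succ_mulVec (t : ℕ) (v : Idx N T S A → ℂ) :
    (P.chain x (t + 1)).mulVec v = (P.Vmat x).mulVec ((P.pre x (t + 1)).mulVec v) := by
  simp [chain, pre, Matrix.mulVec_mulVec]

theorem pre_succ_mulVec (t : ℕ) (v : Idx N T S A → ℂ) :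
    (P.pre x (t + 1)).mulVec v = (extSC (P.U (t + 1))).mulVec ((P.chain x t).mulVec v) := by
  simp [pre, Matrix.mulVec_mulVec]

/-- After `t` activations every flag is at most `t`. -/
theorem chain_flag_le (t : ℕ) (p : Idx N T S A)
    (hp : (P.chain x t).mulVec P.ket0 p ≠ 0) (i : Fin N) : (p.2.2.2 i : ℕ) ≤ t := by
  induction t generalizing p i with
  | zero =>
    simp only [chain, Matrix.one_mulVec, ket0, ne_eq, ite_eq_right_iff, one_ne_zero,
      imp_false, not_not] at hp
    simp [hp]
  | succ t ih =>
    rw [chain_succ_mulVec, pre_succ_mulVec] at hp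
    exact Vmat_mulVec_flag_le P x (extSC_mulVec_flag_le ih) p hp i

/-- If no flag of `v` can wrap around, activation kills exactly the unraised component in which
some lab is active. -/
theorem unraisedWeight_Vmat_mulVec {v : Idx N T S A → ℂ}
    (hv : ∀ p, v p ≠ 0 → ∀ i, (p.2.2.2 i : ℕ) < T) :
    unraisedWeight ((P.Vmat x).mulVec v) =
      ∑ p, if p.2.1 = 0 ∧ p.2.2.2 = (fun _ => 0) then Complex.normSq (v p) else 0 := by
  refine Finset.sum_congr rfl fun p _ => ?_
  by_cases h0 : p.2.1 = 0
  · simp [Vmat_mulVec_of_control_zero P x v h0, h0]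
  by_cases hf : p.2.2.2 = fun _ => 0
  · have hz : (P.Vmat x).mulVec v p = 0 := by
      by_contra h
      obtain ⟨q, hq, -, heq⟩ := exists_of_Vmat_mulVec_ne_zero P x h0 h
      have hlt := hv q hq (p.2.1.pred h0)
      have hval := congrArg Fin.val heq
      rw [Fin.val_add_one_of_lt (Fin.lt_def.mpr (by simpa using hlt)), hf] at hval
      simp at hval
    simp [h0, hz]
  · simp [hf]

theorem unraisedWeight_Uop (hN : 1 ≤ N) (hT : 1 ≤ T) (hflag : P.flagOK x) :
    unraisedWeight ((P.Uop x).mulVec P.ket0) = 0 := by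
  refine Finset.sum_eq_zero fun p _ => ?_
  split_ifs with hf
  · rw [Complex.normSq_eq_zero]
    by_contra h
    have h1 := congrArg Fin.val (hflag p h ⟨0, hN⟩)
    rw [hf, Fin.coe_ofNat_eq_mod, Nat.mod_eq_of_lt (by omega)] at h1
    simp at h1
    omega
  · rfl

variable [∀ i, Fintype (X i)] [∀ i, DecidableEq (X i)]

theorem nsq_psi_nil (l : Fin (N + 1)) (t : ℕ) :
    nsq (P.psi x l t ([] : Hist N A X)) =
      ∑ p, if p.2.1 = l ∧ p.2.2.2 = (fun _ => 0)
        then Complex.normSq ((P.pre x t).mulVec P.ket0 p) else 0 := by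
  refine Finset.sum_congr rfl fun p _ => ?_
  simp [psi, histSat, funext_iff, apply_ite Complex.normSq]

theorem sum_nsq_psi_nil (t : ℕ) :
    ∑ l, nsq (P.psi x l t ([] : Hist N A X)) =
      unraisedWeight ((P.pre x t).mulVec P.ket0) := by
  simp only [nsq_psi_nil]
  rw [Finset.sum_comm]
  refine Finset.sum_congr rfl fun p _ => ?_
  simp [ite_and]

/-- The weight leaving the unraised subspace at an activation is the weight of the branches in
which some lab acts first at that time. -/
theorem unraisedWeight_chain_succ (hU : P.unitaryU) {t : ℕ} (ht : t < T) :
    unraisedWeight ((P.chain x t).mulVec P.ket0) =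
      unraisedWeight ((P.chain x (t + 1)).mulVec P.ket0) +
        ∑ l : Fin N, nsq (P.psi x l.succ (t + 1) ([] : Hist N A X)) := by
  have hpre : ∀ p, (P.pre x (t + 1)).mulVec P.ket0 p ≠ 0 → ∀ i, (p.2.2.2 i : ℕ) < T := by
    intro p hp i
    rw [pre_succ_mulVec] at hp
    exact (extSC_mulVec_flag_le (P.chain_flag_le x t) p hp i).trans_lt ht
  rw [← unraisedWeight_extSC_mulVec (hU (t + 1) t.succ_pos ht), ← pre_succ_mulVec,
    ← sum_nsq_psi_nil, Fin.sum_univ_succ, chain_succ_mulVec, unraisedWeight_Vmat_mulVec P x hpre,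
    nsq_psi_nil]

theorem sum_nsq_psi_add_unraisedWeight (hU : P.unitaryU) {n : ℕ} (hn : n ≤ T) :
    ∑ t ∈ Finset.Icc 1 n, ∑ l : Fin N, nsq (P.psi x l.succ t ([] : Hist N A X)) +
      unraisedWeight ((P.chain x n).mulVec P.ket0) = 1 := by
  induction n with
  | zero =>
    have h (p : Idx N T S A) : (if p.2.2.2 = (fun _ => 0) then Complex.normSq (P.ket0 p) else 0) =
        if p = (P.s0, 0, P.r0, fun _ => 0) then (1 : ℝ) else 0 := by
      by_cases hp : p = (P.s0, 0, P.r0, fun _ => 0) <;> simp [ket0, hp]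
    simp [chain, unraisedWeight, h]
  | succ n ih =>
    rw [Finset.sum_Icc_succ_top (by omega), ← ih (by omega), unraisedWeight_chain_succ P x hU hn]
    ring

end Protocol

end CIQ

open CIQ CIQ.Protocol

/-- **Result 2**: under the flag constraint, the denominator of the first
'who is next?' probability equals one:
`Σ_(l_1=1)^N Σ_(t_1=1)^T ‖ψ_(l_1,t_1,H_0)‖² = 1` for the empty history `H_0`. -/
theorem result_two
    (N T : ℕ) (S : Type) [Fintype S] [DecidableEq S]
    (A : Fin N → Type) [∀ i, Fintype (A i)] [∀ i, DecidableEq (A i)]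
    (X : Fin N → Type) [∀ i, Fintype (X i)] [∀ i, DecidableEq (X i)]
    (hN : 1 ≤ N) (hT : N ≤ T)
    (P : Protocol N T S A X) (hVm : P.unitaryVm) (hU : P.unitaryU)
    (x : ∀ l, X l) (hflag : P.flagOK x) :
    ∑ l : Fin N, ∑ t ∈ Finset.Icc 1 T, nsq (P.psi x l.succ t ([] : Hist N A X)) = 1 := by
  rw [Finset.sum_comm]
  have h := P.sum_nsq_psi_add_unraisedWeight x hU le_rfl
  rwa [show P.chain x T = P.Uop x from rfl, P.unraisedWeight_Uop x hN (hN.trans hT) hflag,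
    add_zero] at h
end
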